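/- arXiv:1605.06912 — 2 statements merged into one kernel-verified Lean document; each statement's English description precedes it below -/
import Mathlib

section
/- Let 0 < α < 1, x > 0, and let y be smooth (C^∞) on [0, x] with y'(0) = 0. Define the weights σ̄₀ = 1 − 2ζ(α), σ̄₁ = 2^{−α} + 2ζ(α), σ̄_k = (k+1)^{−α} − (k−1)^{−α} for 2 ≤ k ≤ n−2, σ̄_{n−1} = −(n−2)^{−α}, σ̄_n = −(n−1)^{−α}. Then there exists a constant C > 0 (independent of n) such that for all integers n ≥ 4, with h = x/n, | (1/(2Γ(1−α)h^α)) Σ_{k=0}^{n} σ̄_k y(x−kh) − D^α y(x) − ((ζ(α) − 2ζ(α−1))/(2Γ(1−α))) y''(x) h^{2−α} | ≤ C h². -/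
/-- Real values of the Riemann zeta function at real arguments
(real part of the analytic continuation). -/
noncomputable def zr (s : ℝ) : ℝ := (riemannZeta s).re

/-- The Caputo derivative of order `α` of `y` at `x`. -/
noncomputable def caputo (α : ℝ) (y : ℝ → ℝ) (x : ℝ) : ℝ :=
  (1 / Real.Gamma (1 - α)) * ∫ t in (0:ℝ)..x, deriv y t / (x - t) ^ α

open Set Filter Topology

/-- Error of the trapezoidal rule on a single interval, for a vector-valued function. -/
theorem norm_trapezoid_error_le {E : Type*} [NormedAddCommGroup E] [NormedSpace ℝ E]
    {F f f' f'' : ℝ → E} {a b M : ℝ} (hab : a ≤ b)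
    (hF : ∀ t ∈ Icc a b, HasDerivAt F (f t) t) (hf : ∀ t ∈ Icc a b, HasDerivAt f (f' t) t)
    (hf' : ∀ t ∈ Icc a b, HasDerivAt f' (f'' t) t) (hM : ∀ t ∈ Icc a b, ‖f'' t‖ ≤ M) :
    ‖((b - a) / 2) • (f a + f b) - (F b - F a)‖ ≤ M * (b - a) ^ 3 := by
  have ha : a ∈ Icc a b := left_mem_Icc.2 hab
  have hb : b ∈ Icc a b := right_mem_Icc.2 hab
  have hM0 : 0 ≤ M := (norm_nonneg _).trans (hM a ha)
  have hba : 0 ≤ b - a := sub_nonneg.2 hab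
  have hlin : ∀ t, HasDerivAt (fun t : ℝ => (t - a) / 2) (1 / 2) t := fun t =>
    ((hasDerivAt_id t).sub_const a).div_const 2
  have h1 : ∀ t ∈ Icc a b,
      ‖((t - a) / 2) • f' t - (1 / 2 : ℝ) • (f t - f a)‖ ≤ M * (b - a) ^ 2 := by
    intro t ht
    have hd : ∀ u ∈ Icc a b, HasDerivWithinAt
        (fun t => ((t - a) / 2) • f' t - (1 / 2 : ℝ) • (f t - f a))
        (((u - a) / 2) • f'' u) (Icc a b) u := by
      intro u hu
      refine HasDerivAt.hasDerivWithinAt ?_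
      refine (((hlin u).smul (hf' u hu)).sub
        (((hf u hu).sub_const (f a)).const_smul (1 / 2 : ℝ))).congr_deriv ?_
      abel
    have := (convex_Icc a b).norm_image_sub_le_of_norm_hasDerivWithin_le (C := (b - a) * M) hd
      (fun u hu => by
        rw [norm_smul, Real.norm_of_nonneg (by linarith [hu.1])]
        exact mul_le_mul (by linarith [hu.1, hu.2]) (hM u hu) (norm_nonneg _) hba) ha ht
    simp only [sub_self, zero_div, zero_smul, smul_zero, sub_zero] at this
    refine this.trans ?_
    rw [Real.norm_of_nonneg (by linarith [ht.1])]
    nlinarith [mul_le_mul_of_nonneg_left (sub_le_sub_right ht.2 a) (mul_nonneg hba hM0)]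
  have hd : ∀ u ∈ Icc a b, HasDerivWithinAt
      (fun t => ((t - a) / 2) • (f a + f t) - (F t - F a))
      (((u - a) / 2) • f' u - (1 / 2 : ℝ) • (f u - f a)) (Icc a b) u := by
    intro u hu
    refine HasDerivAt.hasDerivWithinAt ?_
    refine (((hlin u).smul ((hf u hu).const_add (f a))).sub
      ((hF u hu).sub_const (F a))).congr_deriv ?_
    module
  have := (convex_Icc a b).norm_image_sub_le_of_norm_hasDerivWithin_le hd h1 ha hb
  simp only [sub_self, zero_div, zero_smul, sub_zero] at this
  refine this.trans (le_of_eq ?_)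
  rw [Real.norm_of_nonneg hba]
  ring

/-- The summand of the Euler–Maclaurin series of `(s - 1) ζ(s)`. -/
noncomputable def zetaTrapezoid (k : ℕ) (s : ℂ) : ℂ :=
  (s - 1) / 2 * (((k : ℂ) + 1) ^ (-s) + ((k : ℂ) + 2) ^ (-s))
    - (((k : ℂ) + 1) ^ (1 - s) - ((k : ℂ) + 2) ^ (1 - s))

theorem hasDerivAt_ofReal_cpow_of_pos {t : ℝ} (ht : 0 < t) (r : ℂ) :
    HasDerivAt (fun u : ℝ => (u : ℂ) ^ r) (r * (t : ℂ) ^ (r - 1)) t := by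
  have h := ((hasDerivAt_id (t : ℂ)).cpow_const (c := r) (by simpa using ht)).comp_ofReal
  simpa using h

theorem norm_zetaTrapezoid_le (k : ℕ) (s : ℂ) (hs : -1 < s.re) :
    ‖zetaTrapezoid k s‖ ≤ ‖(s - 1) * s * (s + 1)‖ * ((k : ℝ) + 1) ^ (-s.re - 2) := by
  have hk : (0 : ℝ) < (k : ℝ) + 1 := by positivity
  have h := norm_trapezoid_error_le (a := (k : ℝ) + 1) (b := (k : ℝ) + 2)
    (F := fun t : ℝ => -(t : ℂ) ^ (1 - s)) (f := fun t : ℝ => (s - 1) * (t : ℂ) ^ (-s))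
    (f' := fun t : ℝ => (s - 1) * (-s) * (t : ℂ) ^ (-s - 1))
    (f'' := fun t : ℝ => (s - 1) * s * (s + 1) * (t : ℂ) ^ (-s - 2))
    (M := ‖(s - 1) * s * (s + 1)‖ * ((k : ℝ) + 1) ^ (-s.re - 2)) (by linarith)
    (fun t ht => by
      refine (hasDerivAt_ofReal_cpow_of_pos (hk.trans_le ht.1) (1 - s)).neg.congr_deriv ?_
      rw [show 1 - s - 1 = -s by ring]; ring)
    (fun t ht => by
      refine ((hasDerivAt_ofReal_cpow_of_pos (hk.trans_le ht.1) (-s)).const_mul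
        (s - 1)).congr_deriv ?_
      ring)
    (fun t ht => by
      refine ((hasDerivAt_ofReal_cpow_of_pos (hk.trans_le ht.1) (-s - 1)).const_mul
        ((s - 1) * (-s))).congr_deriv ?_
      rw [show -s - 1 - 1 = -s - 2 by ring]; ring)
    (fun t ht => by
      rw [norm_mul, Complex.norm_cpow_eq_rpow_re_of_pos (hk.trans_le ht.1)]
      refine mul_le_mul_of_nonneg_left ?_ (norm_nonneg _)
      simpa using Real.rpow_le_rpow_of_nonpos hk ht.1 (by linarith : -s.re - 2 ≤ 0))
  refine (le_of_eq ?_).trans (h.trans_eq ?_)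
  · rw [zetaTrapezoid, Complex.real_smul]; push_cast; ring_nf
  · ring

theorem differentiable_zetaTrapezoid (k : ℕ) : Differentiable ℂ (zetaTrapezoid k) := by
  intro s
  have h1 : (k : ℂ) + 1 ≠ 0 := by exact_mod_cast (Nat.succ_ne_zero k)
  have h2 : (k : ℂ) + 2 ≠ 0 := by exact_mod_cast (Nat.succ_ne_zero (k + 1))
  unfold zetaTrapezoid
  fun_prop (disch := simp [h1, h2])

theorem sum_zetaTrapezoid (N : ℕ) (s : ℂ) :
    ∑ k ∈ Finset.range N, zetaTrapezoid k s =
      (s - 1) * (∑ k ∈ Finset.range N, ((k : ℂ) + 1) ^ (-s) - 1 / 2 + ((N : ℂ) + 1) ^ (-s) / 2)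
        - 1 + ((N : ℂ) + 1) ^ (1 - s) := by
  induction N with
  | zero => simp
  | succ N ih =>
    rw [Finset.sum_range_succ, Finset.sum_range_succ, ih, zetaTrapezoid]
    push_cast
    rw [show (N : ℂ) + 1 + 1 = N + 2 by ring]
    ring

theorem tendsto_natCast_add_one_cpow {r : ℂ} (hr : r.re < 0) :
    Tendsto (fun N : ℕ => ((N : ℂ) + 1) ^ r) atTop (𝓝 0) := by
  rw [tendsto_zero_iff_norm_tendsto_zero]
  have h := ((tendsto_rpow_neg_atTop (neg_pos.2 hr)).comp
    (tendsto_atTop_add_const_right _ (1 : ℝ) tendsto_natCast_atTop_atTop))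
  refine h.congr fun N => ?_
  have : ((N : ℂ) + 1) = (((N : ℝ) + 1 : ℝ) : ℂ) := by push_cast; ring
  simp only [Function.comp]
  rw [this, Complex.norm_cpow_eq_rpow_re_of_pos (by positivity), neg_neg]

theorem summable_add_one_rpow {p : ℝ} (hp : p < -1) :
    Summable fun k : ℕ => ((k : ℝ) + 1) ^ p := by
  have := (summable_nat_add_iff 1).2 (Real.summable_nat_rpow.2 hp)
  simpa using this

theorem hasSum_zetaTrapezoid_of_one_lt {s : ℂ} (hs : 1 < s.re) :
    HasSum (fun k => zetaTrapezoid k s) ((s - 1) * (riemannZeta s - 1 / 2) - 1) := by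
  have hsum : Summable fun k => zetaTrapezoid k s := by
    refine Summable.of_norm_bounded ((summable_add_one_rpow ?_).mul_left _)
      fun k => norm_zetaTrapezoid_le k s (by linarith)
    linarith
  have hz : Tendsto (fun N : ℕ => ∑ k ∈ Finset.range N, ((k : ℂ) + 1) ^ (-s)) atTop
      (𝓝 (riemannZeta s)) := by
    have h1 : Summable fun k : ℕ => ((k : ℂ) + 1) ^ (-s) := by
      have := (summable_nat_add_iff 1).2 (Complex.summable_one_div_nat_cpow.2 hs)
      refine this.congr fun k => ?_
      rw [Complex.cpow_neg]; push_cast; simp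
    have h2 : riemannZeta s = ∑' k : ℕ, ((k : ℂ) + 1) ^ (-s) := by
      rw [zeta_eq_tsum_one_div_nat_add_one_cpow hs]
      exact tsum_congr fun k => by rw [Complex.cpow_neg, one_div]
    rw [h2]
    exact h1.hasSum.tendsto_sum_nat
  have hlim := hsum.hasSum.tendsto_sum_nat
  simp_rw [sum_zetaTrapezoid] at hlim
  have hA := tendsto_natCast_add_one_cpow (r := -s) (by simp; linarith)
  have hB := tendsto_natCast_add_one_cpow (r := 1 - s) (by simp; linarith)
  have hlim' := ((((hz.sub_const (1 / 2)).add (hA.div_const 2)).const_mul (s - 1)).sub_const 1).add hB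
  have := tendsto_nhds_unique hlim hlim'
  convert hsum.hasSum using 1
  rw [this]; ring

theorem hasSum_zetaTrapezoid {s : ℝ} (hs : -1 < s) (hs1 : s < 1) :
    HasSum (fun k => zetaTrapezoid k s) (((s : ℂ) - 1) * (riemannZeta s - 1 / 2) - 1) := by
  set σ : ℝ := (s - 1) / 2 with hσ
  set U : Set ℂ := Metric.ball (2 : ℂ) (2 - σ) with hU
  have hre : ∀ z ∈ U, σ < z.re ∧ ‖z‖ ≤ 5 := by
    intro z hz
    rw [hU, mem_ball_iff_norm] at hz
    have h1 := (Complex.abs_re_le_norm (z - 2)).trans_lt hz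
    rw [abs_lt] at h1
    simp at h1
    refine ⟨by linarith [h1.1], ?_⟩
    have := norm_le_norm_sub_add z 2
    simp at this
    linarith
  have hbd : ∀ (k : ℕ), ∀ z ∈ U, ‖zetaTrapezoid k z‖ ≤ 180 * ((k : ℝ) + 1) ^ (-σ - 2) := by
    intro k z hz
    obtain ⟨h1, h2⟩ := hre z hz
    refine (norm_zetaTrapezoid_le k z (by linarith)).trans ?_
    have e1 : ‖z - 1‖ ≤ 6 := (norm_sub_le _ _).trans (by simp; linarith)
    have e2 : ‖z + 1‖ ≤ 6 := (norm_add_le _ _).trans (by simp; linarith)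
    have e3 : ‖(z - 1) * z * (z + 1)‖ ≤ 180 := by
      rw [norm_mul, norm_mul]
      calc _ ≤ (6 : ℝ) * 5 * 6 := by gcongr
        _ = 180 := by norm_num
    refine mul_le_mul e3 ?_ (by positivity) (by norm_num)
    exact Real.rpow_le_rpow_of_exponent_le (by linarith [(Nat.cast_nonneg k : (0 : ℝ) ≤ k)])
      (by linarith)
  have hsu : Summable fun k : ℕ => 180 * ((k : ℝ) + 1) ^ (-σ - 2) :=
    (summable_add_one_rpow (by linarith)).mul_left _
  have hdiff : DifferentiableOn ℂ (fun z => ∑' k, zetaTrapezoid k z) U :=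
    Complex.differentiableOn_tsum_of_summable_norm hsu
      (fun k => (differentiable_zetaTrapezoid k).differentiableOn) Metric.isOpen_ball hbd
  have hdiff2 : Differentiable ℂ fun z => riemannZeta₁ z - (z - 1) / 2 - 1 := by
    have := differentiable_riemannZeta₁
    fun_prop
  have hz1 : ∀ z : ℂ, z ≠ 1 →
      riemannZeta₁ z - (z - 1) / 2 - 1 = (z - 1) * (riemannZeta z - 1 / 2) - 1 := by
    intro z hz
    rw [riemannZeta_eq_inv_sub_mul hz]
    have := sub_ne_zero.2 hz
    field_simp
  have h2U : (2 : ℂ) ∈ U := Metric.mem_ball_self (by linarith)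
  have heq : EqOn (fun z => ∑' k, zetaTrapezoid k z)
      (fun z => riemannZeta₁ z - (z - 1) / 2 - 1) U := by
    refine AnalyticOnNhd.eqOn_of_preconnected_of_eventuallyEq
      (hdiff.analyticOnNhd Metric.isOpen_ball)
      (hdiff2.differentiableOn.analyticOnNhd Metric.isOpen_ball)
      (convex_ball _ _).isPreconnected h2U ?_
    have : ∀ᶠ z : ℂ in 𝓝 2, 1 < z.re :=
      (isOpen_lt continuous_const Complex.continuous_re).mem_nhds (by simp)
    filter_upwards [this] with z hz
    rw [(hasSum_zetaTrapezoid_of_one_lt hz).tsum_eq, hz1]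
    rintro rfl
    simp at hz
  have hsU : (s : ℂ) ∈ U := by
    rw [hU, mem_ball_iff_norm, show (s : ℂ) - 2 = ((s - 2 : ℝ) : ℂ) by push_cast; ring,
      Complex.norm_real, Real.norm_eq_abs, abs_lt]
    constructor <;> linarith
  have hsum : Summable fun k => zetaTrapezoid k (s : ℂ) :=
    Summable.of_norm_bounded hsu fun k => hbd k s hsU
  rw [← hz1 _ (by exact_mod_cast hs1.ne)]
  have htsum : ∑' k, zetaTrapezoid k (s : ℂ) = riemannZeta₁ s - (s - 1) / 2 - 1 := heq hsU
  rw [← htsum]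
  exact hsum.hasSum

theorem rpow_neg_sub_one_le {m p : ℝ} (hm : 1 ≤ m) (hp : 0 < p) :
    m ^ (-p - 1) ≤ 2 ^ (p + 1) / p * (m ^ (-p) - (m + 1) ^ (-p)) := by
  obtain ⟨c, hc, hc'⟩ := exists_hasDerivAt_eq_slope (fun t : ℝ => t ^ (-p))
    (fun t => -p * t ^ (-p - 1)) (by linarith : m < m + 1)
    (fun t ht => (Real.continuousAt_rpow_const _ _ (Or.inl (by linarith [ht.1]))).continuousWithinAt)
    (fun t ht => Real.hasDerivAt_rpow_const (Or.inl (by linarith [ht.1])))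
  have hslope : m ^ (-p) - (m + 1) ^ (-p) = p * c ^ (-p - 1) := by
    have : m + 1 - m = 1 := by ring
    rw [this, div_one] at hc'
    linarith
  have h1 : (2 * m) ^ (-p - 1) ≤ c ^ (-p - 1) :=
    Real.rpow_le_rpow_of_nonpos (by linarith [hc.1]) (by linarith [hc.2]) (by linarith)
  rw [Real.mul_rpow (by norm_num) (by linarith), show -p - 1 = -(p + 1) by ring,
    Real.rpow_neg (by norm_num : (0 : ℝ) ≤ 2)] at h1
  rw [hslope, show -p - 1 = -(p + 1) by ring]
  have h2 : (0 : ℝ) < 2 ^ (p + 1) := by positivity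
  have : 2 ^ (p + 1) / p * (p * c ^ (-(p + 1))) = 2 ^ (p + 1) * c ^ (-(p + 1)) := by
    field_simp
  rw [this]
  calc m ^ (-(p + 1)) = 2 ^ (p + 1) * ((2 ^ (p + 1))⁻¹ * m ^ (-(p + 1))) := by field_simp
    _ ≤ _ := by gcongr

/-- Euler–Maclaurin asymptotics of the partial sums of `∑ k ^ (-s)`, with second order error. -/
theorem exists_abs_sum_rpow_sub_zr_le {s : ℝ} (hs : -1 < s) (hs1 : s < 1) :
    ∃ C, 0 ≤ C ∧ ∀ N : ℕ,
      |∑ k ∈ Finset.range N, ((k : ℝ) + 1) ^ (-s) + ((N : ℝ) + 1) ^ (-s) / 2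
        - ((N : ℝ) + 1) ^ (1 - s) / (1 - s) - zr s| ≤ C * ((N : ℝ) + 1) ^ (-s - 1) := by
  set A : ℝ := ‖((s : ℂ) - 1) * s * (s + 1)‖ * (2 ^ (s + 1 + 1) / (s + 1)) with hA
  have hs' : 0 < s + 1 := by linarith
  have hA0 : 0 ≤ A := by positivity
  have hone : 0 < 1 - s := by linarith
  have hterm : ∀ k : ℕ, ‖zetaTrapezoid k s‖ ≤
      A * (((k : ℝ) + 1) ^ (-(s + 1)) - ((k : ℝ) + 1 + 1) ^ (-(s + 1))) := by
    intro k
    refine (norm_zetaTrapezoid_le k s (by simpa using hs)).trans ?_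
    rw [hA, mul_assoc ‖_‖]
    refine mul_le_mul_of_nonneg_left ?_ (norm_nonneg _)
    have := rpow_neg_sub_one_le (m := (k : ℝ) + 1) (p := s + 1)
      (by linarith [(Nat.cast_nonneg k : (0 : ℝ) ≤ k)]) hs'
    rwa [show -(s + 1) - 1 = -(s : ℂ).re - 2 by rw [Complex.ofReal_re]; ring] at this
  set L : ℂ := ((s : ℂ) - 1) * (riemannZeta s - 1 / 2) - 1 with hL
  have htail : ∀ N : ℕ, ‖∑ k ∈ Finset.range N, zetaTrapezoid k s - L‖ ≤
      A * ((N : ℝ) + 1) ^ (-(s + 1)) := by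
    intro N
    have hpart : ∀ j : ℕ, ‖∑ k ∈ Finset.range N, zetaTrapezoid k s
        - ∑ k ∈ Finset.range (j + N), zetaTrapezoid k s‖ ≤
        A * (((N : ℝ) + 1) ^ (-(s + 1)) - ((j : ℝ) + N + 1) ^ (-(s + 1))) := by
      intro j
      induction j with
      | zero => simp
      | succ j ih =>
        rw [show j + 1 + N = j + N + 1 by ring, Finset.sum_range_succ, ← sub_sub]
        have := hterm (j + N)
        push_cast at this ⊢
        rw [show (j : ℝ) + 1 + N + 1 = j + N + 1 + 1 by ring]
        linarith [norm_sub_le (∑ k ∈ Finset.range N, zetaTrapezoid k s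
          - ∑ k ∈ Finset.range (j + N), zetaTrapezoid k s) (zetaTrapezoid (j + N) s)]
    have hlim : Tendsto (fun j : ℕ => ‖∑ k ∈ Finset.range N, zetaTrapezoid k s
        - ∑ k ∈ Finset.range (j + N), zetaTrapezoid k s‖) atTop
        (𝓝 ‖∑ k ∈ Finset.range N, zetaTrapezoid k s - L‖) :=
      (((tendsto_add_atTop_iff_nat N).2
        (hasSum_zetaTrapezoid hs hs1).tendsto_sum_nat).const_sub _).norm
    refine le_of_tendsto' hlim fun j => (hpart j).trans ?_
    exact mul_le_mul_of_nonneg_left (sub_le_self _ (by positivity)) hA0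
  refine ⟨A / (1 - s), by positivity, fun N => ?_⟩
  have h := (Complex.abs_re_le_norm _).trans (htail N)
  rw [sum_zetaTrapezoid] at h
  have hcast : ∀ (k : ℕ) (r : ℝ), ((k : ℂ) + 1) ^ (r : ℂ) = ((((k : ℝ) + 1) ^ r : ℝ) : ℂ) := by
    intro k r
    rw [Complex.ofReal_cpow (by positivity)]; push_cast; rfl
  have hre : (((s : ℂ) - 1) * (∑ k ∈ Finset.range N, ((k : ℂ) + 1) ^ (-(s : ℂ)) - 1 / 2
        + ((N : ℂ) + 1) ^ (-(s : ℂ)) / 2) - 1 + ((N : ℂ) + 1) ^ (1 - (s : ℂ)) - L).re =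
      (s - 1) * (∑ k ∈ Finset.range N, ((k : ℝ) + 1) ^ (-s) + ((N : ℝ) + 1) ^ (-s) / 2
        - ((N : ℝ) + 1) ^ (1 - s) / (1 - s) - zr s) := by
    have e1 : (-(s : ℂ)) = ((-s : ℝ) : ℂ) := by push_cast; rfl
    have e2 : (1 - (s : ℂ)) = ((1 - s : ℝ) : ℂ) := by push_cast; rfl
    rw [e1, e2]
    simp_rw [hcast]
    rw [← Complex.ofReal_sum, hL]
    have e3 : ∀ X a b : ℝ, ((s : ℂ) - 1) * ((X : ℂ) - 1 / 2 + (a : ℂ) / 2) - 1 + (b : ℂ)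
        - (((s : ℂ) - 1) * (riemannZeta s - 1 / 2) - 1)
        = ((s - 1 : ℝ) : ℂ) * (((X + a / 2 : ℝ) : ℂ) - riemannZeta s) + (b : ℂ) := by
      intro X a b; push_cast; ring
    rw [e3, Complex.add_re, Complex.re_ofReal_mul, Complex.sub_re, Complex.ofReal_re,
      Complex.ofReal_re, zr]
    field_simp
    ring
  rw [hre, abs_mul, abs_of_neg (by linarith), show -(s + 1) = -s - 1 by ring] at h
  rw [div_mul_eq_mul_div, le_div_iff₀ hone]
  linarith

theorem exists_sum_rpow_neg_le {α : ℝ} (hα0 : 0 < α) (hα1 : α < 1) :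
    ∃ B, 0 ≤ B ∧ ∀ N : ℕ,
      ∑ k ∈ Finset.range N, ((k : ℝ) + 1) ^ (-α) ≤ B * ((N : ℝ) + 1) ^ (1 - α) := by
  obtain ⟨C, hC0, hC⟩ := exists_abs_sum_rpow_sub_zr_le (s := α) (by linarith) hα1
  have h1α : 0 < 1 - α := by linarith
  refine ⟨C + 1 / (1 - α) + |zr α|, by positivity, fun N => ?_⟩
  have hN : (1 : ℝ) ≤ (N : ℝ) + 1 := by linarith [(Nat.cast_nonneg N : (0 : ℝ) ≤ N)]
  have h := (abs_le.1 (hC N)).2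
  have e1 : ((N : ℝ) + 1) ^ (-α - 1) ≤ ((N : ℝ) + 1) ^ (1 - α) :=
    Real.rpow_le_rpow_of_exponent_le hN (by linarith)
  have e2 : 1 ≤ ((N : ℝ) + 1) ^ (1 - α) := Real.one_le_rpow hN h1α.le
  have e3 : 0 ≤ ((N : ℝ) + 1) ^ (-α) / 2 := by positivity
  have e4 := mul_le_mul_of_nonneg_left e1 hC0
  have e5 := mul_le_mul_of_nonneg_left e2 (abs_nonneg (zr α))
  have e6 := le_abs_self (zr α)
  have e7 : ((N : ℝ) + 1) ^ (1 - α) / (1 - α) = 1 / (1 - α) * ((N : ℝ) + 1) ^ (1 - α) := by ring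
  linarith

theorem abs_taylor_one_le {f f' f'' : ℝ → ℝ} {a b M : ℝ}
    (hf : ∀ t, HasDerivAt f (f' t) t) (hf' : ∀ t, HasDerivAt f' (f'' t) t)
    (hM : ∀ t ∈ Icc a b, |f'' t| ≤ M) {u v : ℝ} (hu : u ∈ Icc a b) (hv : v ∈ Icc a b) :
    |f v - f u - (v - u) * f' u| ≤ M * |v - u| ^ 2 := by
  have hsub : uIcc u v ⊆ Icc a b := uIcc_subset_Icc hu hv
  have hM0 : 0 ≤ M := (abs_nonneg _).trans (hM u hu)
  have h1 : ∀ t ∈ uIcc u v, ‖f' t - f' u‖ ≤ M * |v - u| := fun t ht =>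
    ((convex_Icc a b).norm_image_sub_le_of_norm_hasDerivWithin_le
      (fun s _ => (hf' s).hasDerivWithinAt) hM hu (hsub ht)).trans
      (mul_le_mul_of_nonneg_left (abs_sub_left_of_mem_uIcc ht) hM0)
  have h2 := (convex_uIcc u v).norm_image_sub_le_of_norm_hasDerivWithin_le
    (f := fun t => f t - (t - u) * f' u) (f' := fun t => f' t - f' u)
    (fun t _ => (((hf t).sub (((hasDerivAt_id t).sub_const u).mul_const (f' u))).congr_deriv
      (by ring)).hasDerivWithinAt) h1 left_mem_uIcc right_mem_uIcc
  simp only [Real.norm_eq_abs] at h2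
  calc _ = |f v - (v - u) * f' u - (f u - (u - u) * f' u)| := by congr 1; ring
    _ ≤ _ := h2
    _ = _ := by ring

theorem abs_taylor_two_le {f f' f'' f''' : ℝ → ℝ} {a b M : ℝ}
    (hf : ∀ t, HasDerivAt f (f' t) t) (hf' : ∀ t, HasDerivAt f' (f'' t) t)
    (hf'' : ∀ t, HasDerivAt f'' (f''' t) t)
    (hM : ∀ t ∈ Icc a b, |f''' t| ≤ M) {u v : ℝ} (hu : u ∈ Icc a b) (hv : v ∈ Icc a b) :
    |f v - f u - (v - u) * f' u - (v - u) ^ 2 / 2 * f'' u| ≤ M * |v - u| ^ 3 := by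
  have hsub : uIcc u v ⊆ Icc a b := uIcc_subset_Icc hu hv
  have hM0 : 0 ≤ M := (abs_nonneg _).trans (hM u hu)
  have h1 : ∀ t ∈ uIcc u v, ‖f' t - f' u - (t - u) * f'' u‖ ≤ M * |v - u| ^ 2 := fun t ht =>
    (abs_taylor_one_le hf' hf'' hM hu (hsub ht)).trans
      (mul_le_mul_of_nonneg_left (pow_le_pow_left₀ (abs_nonneg _) (abs_sub_left_of_mem_uIcc ht) 2) hM0)
  have h2 := (convex_uIcc u v).norm_image_sub_le_of_norm_hasDerivWithin_le
    (f := fun t => f t - (t - u) * f' u - (t - u) ^ 2 / 2 * f'' u)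
    (f' := fun t => f' t - f' u - (t - u) * f'' u)
    (fun t _ => ((((hf t).sub (((hasDerivAt_id t).sub_const u).mul_const (f' u))).sub
      (((((hasDerivAt_id t).sub_const u).pow 2).div_const 2).mul_const (f'' u))).congr_deriv
      (by simp)).hasDerivWithinAt) h1 left_mem_uIcc right_mem_uIcc
  simp only [Real.norm_eq_abs] at h2
  calc _ = |f v - (v - u) * f' u - (v - u) ^ 2 / 2 * f'' u
        - (f u - (u - u) * f' u - (u - u) ^ 2 / 2 * f'' u)| := by congr 1; ring
    _ ≤ _ := h2
    _ = _ := by ring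

/-- The trapezoidal rule is second order accurate for `t ^ (-α) * r t` when `r` vanishes to second
order at the singularity. -/
theorem exists_trapezoid_rpow_mul_le {α x M : ℝ} (hα0 : 0 < α) (hα1 : α < 1) (hx : 0 < x)
    {r r' r'' : ℝ → ℝ} (hr : ∀ t, HasDerivAt r (r' t) t) (hr' : ∀ t, HasDerivAt r' (r'' t) t)
    (b0 : ∀ t ∈ Icc 0 x, |r t| ≤ M * t ^ 2) (b1 : ∀ t ∈ Icc 0 x, |r' t| ≤ M * t)
    (b2 : ∀ t ∈ Icc 0 x, |r'' t| ≤ M) :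
    ∃ C, 0 ≤ C ∧ ∀ N : ℕ, ∀ h : ℝ, ((N : ℝ) + 1) * h = x →
      |h * ∑ k ∈ Finset.range N, (((k : ℝ) + 1) * h) ^ (-α) * r (((k : ℝ) + 1) * h)
        + h / 2 * (x ^ (-α) * r x) - ∫ t in (0 : ℝ)..x, t ^ (-α) * r t| ≤ C * h ^ 2 := by
  obtain ⟨B, hB0, hB⟩ := exists_sum_rpow_neg_le hα0 hα1
  have hM0 : 0 ≤ M := (abs_nonneg _).trans (b2 0 ⟨le_rfl, hx.le⟩)
  have hrc : Continuous r := continuous_iff_continuousAt.2 fun t => (hr t).continuousAt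
  set φ : ℝ → ℝ := fun t => t ^ (-α) * r t with hφ
  have hint : ∀ a b, IntervalIntegrable φ MeasureTheory.volume a b := fun a b =>
    (intervalIntegral.intervalIntegrable_rpow' (by linarith)).mul_continuousOn hrc.continuousOn
  set Φ : ℝ → ℝ := fun t => ∫ u in (0 : ℝ)..t, φ u
  have hpow : ∀ (p t : ℝ), 0 < t → HasDerivAt (fun u : ℝ => u ^ p) (p * t ^ (p - 1)) t :=
    fun p t ht => Real.hasDerivAt_rpow_const (Or.inl ht.ne')
  have hφc : ∀ t, 0 < t → ContinuousAt φ t := fun t ht =>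
    (hpow _ t ht).continuousAt.mul hrc.continuousAt
  have hΦd : ∀ t, 0 < t → HasDerivAt Φ (φ t) t := fun t ht =>
    intervalIntegral.integral_hasDerivAt_right (hint 0 t)
      (ContinuousOn.stronglyMeasurableAtFilter isOpen_Ioi
        (fun u hu => (hφc u hu).continuousWithinAt) t ht) (hφc t ht)
  set φ' : ℝ → ℝ := fun t => -α * t ^ (-α - 1) * r t + t ^ (-α) * r' t with hφ'
  set φ'' : ℝ → ℝ := fun t => α * (α + 1) * t ^ (-α - 2) * r t - 2 * α * t ^ (-α - 1) * r' t
    + t ^ (-α) * r'' t with hφ''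
  have hφd : ∀ t, 0 < t → HasDerivAt φ (φ' t) t := fun t ht =>
    ((hpow (-α) t ht).mul (hr t))
  have hφ'd : ∀ t, 0 < t → HasDerivAt φ' (φ'' t) t := fun t ht => by
    refine ((((hpow (-α - 1) t ht).const_mul (-α)).mul (hr t)).add
      ((hpow (-α) t ht).mul (hr' t))).congr_deriv ?_
    rw [show -α - 1 - 1 = -α - 2 by ring]
    simp only [hφ'']
    ring
  have hφ''b : ∀ t, 0 < t → t ≤ x → |φ'' t| ≤ 5 * M * t ^ (-α) := by
    intro t ht htx
    have htm : t ∈ Icc 0 x := ⟨ht.le, htx⟩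
    have p0 : 0 < t ^ (-α) := Real.rpow_pos_of_pos ht _
    have q1 : |r t / t ^ 2| ≤ M := by
      rw [abs_div, abs_of_pos (pow_pos ht 2), div_le_iff₀ (pow_pos ht 2)]; exact b0 t htm
    have q2 : |r' t / t| ≤ M := by
      rw [abs_div, abs_of_pos ht, div_le_iff₀ ht]; exact b1 t htm
    have q3 := b2 t htm
    have heq : φ'' t =
        (α * (α + 1) * (r t / t ^ 2) - 2 * α * (r' t / t) + r'' t) * t ^ (-α) := by
      simp only [hφ'']
      rw [Real.rpow_sub ht, Real.rpow_sub_one ht.ne', Real.rpow_two]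
      ring
    rw [heq, abs_mul, abs_of_pos p0]
    refine mul_le_mul_of_nonneg_right ?_ p0.le
    have t1 : |α * (α + 1) * (r t / t ^ 2)| ≤ 2 * M := by
      rw [abs_mul, abs_of_nonneg (by positivity)]
      exact mul_le_mul (by nlinarith) q1 (abs_nonneg _) (by norm_num)
    have t2 : |2 * α * (r' t / t)| ≤ 2 * M := by
      rw [abs_mul, abs_of_nonneg (by positivity)]
      exact mul_le_mul (by linarith) q2 (abs_nonneg _) (by norm_num)
    have t3 := abs_add_le (α * (α + 1) * (r t / t ^ 2) - 2 * α * (r' t / t)) (r'' t)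
    have t4 := abs_sub (α * (α + 1) * (r t / t ^ 2)) (2 * α * (r' t / t))
    linarith
  refine ⟨5 * M * B * x ^ (1 - α) + 2 * M * x ^ (1 - α), by positivity, fun N h hNh => ?_⟩
  have hN : (0 : ℝ) < (N : ℝ) + 1 := by positivity
  have hh : 0 < h := by
    by_contra! hneg
    nlinarith
  have hhx : h ≤ x := by
    rw [← hNh]
    nlinarith [(Nat.cast_nonneg N : (0 : ℝ) ≤ N)]
  have hT : ∀ k ∈ Finset.range N, |h / 2 * (φ (((k : ℝ) + 1) * h) + φ (((k : ℝ) + 2) * h))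
      - (Φ (((k : ℝ) + 2) * h) - Φ (((k : ℝ) + 1) * h))| ≤
      5 * M * h ^ (3 - α) * ((k : ℝ) + 1) ^ (-α) := by
    intro k hk
    have hkN : (k : ℝ) + 1 ≤ N := by exact_mod_cast Finset.mem_range.1 hk
    have hk0 : 0 < ((k : ℝ) + 1) * h := by positivity
    have hpos : ∀ t ∈ Icc (((k : ℝ) + 1) * h) (((k : ℝ) + 2) * h), 0 < t :=
      fun t ht => hk0.trans_le ht.1
    have := norm_trapezoid_error_le (M := 5 * M * (((k : ℝ) + 1) * h) ^ (-α))
      (by nlinarith : ((k : ℝ) + 1) * h ≤ ((k : ℝ) + 2) * h)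
      (fun t ht => hΦd t (hpos t ht)) (fun t ht => hφd t (hpos t ht))
      (fun t ht => hφ'd t (hpos t ht))
      (fun t ht => (hφ''b t (hpos t ht) (by rw [← hNh]; nlinarith [ht.2])).trans
        (mul_le_mul_of_nonneg_left (Real.rpow_le_rpow_of_nonpos hk0 ht.1 (by linarith))
          (by positivity)))
    rw [show ((k : ℝ) + 2) * h - ((k : ℝ) + 1) * h = h by ring, smul_eq_mul,
      Real.norm_eq_abs] at this
    refine this.trans_eq ?_
    rw [Real.mul_rpow (by positivity) hh.le, show 3 - α = (3 : ℕ) + -α by push_cast; ring,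
      Real.rpow_add hh, Real.rpow_natCast]
    ring
  have hfirst : |h / 2 * φ h - Φ h| ≤ 2 * M * h ^ (3 - α) := by
    have hφb : ∀ t, 0 < t → t ≤ h → |φ t| ≤ M * h ^ (2 - α) := by
      intro t ht hth
      simp only [hφ]
      rw [abs_mul, abs_of_pos (Real.rpow_pos_of_pos ht _)]
      calc t ^ (-α) * |r t| ≤ t ^ (-α) * (M * t ^ 2) := by
            gcongr; exact b0 t ⟨ht.le, hth.trans hhx⟩
        _ = M * t ^ (2 - α) := by
            rw [show 2 - α = (2 : ℕ) + -α by push_cast; ring, Real.rpow_add ht, Real.rpow_natCast]; ring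
        _ ≤ M * h ^ (2 - α) := by
            gcongr; linarith
    have h1 : |Φ h| ≤ M * h ^ (2 - α) * h := by
      have := intervalIntegral.norm_integral_le_of_norm_le_const (a := 0) (b := h) (f := φ)
        (C := M * h ^ (2 - α)) (fun t ht => by
          rw [uIoc_of_le hh.le] at ht
          exact hφb t ht.1 ht.2)
      rwa [sub_zero, abs_of_pos hh] at this
    have h2 := hφb h hh le_rfl
    have h3 : h ^ (3 - α) = h ^ (2 - α) * h := by
      rw [show 3 - α = (2 - α) + 1 by ring, Real.rpow_add_one hh.ne']
    have h4 := abs_sub (h / 2 * φ h) (Φ h)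
    rw [abs_mul, abs_of_pos (half_pos hh)] at h4
    have h5 := mul_le_mul_of_nonneg_left h2 (half_pos hh).le
    have h6 : 0 ≤ M * h ^ (2 - α) * h := by positivity
    rw [h3]
    linarith
  have hsum : ∀ n : ℕ, ∑ k ∈ Finset.range n, (h / 2 * (φ (((k : ℝ) + 1) * h)
      + φ (((k : ℝ) + 2) * h)) - (Φ (((k : ℝ) + 2) * h) - Φ (((k : ℝ) + 1) * h))) =
      h * ∑ k ∈ Finset.range n, φ (((k : ℝ) + 1) * h) + h / 2 * φ (((n : ℝ) + 1) * h)
        - Φ (((n : ℝ) + 1) * h) - (h / 2 * φ h - Φ h) := by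
    intro n
    induction n with
    | zero => simp
    | succ n ih =>
      rw [Finset.sum_range_succ, Finset.sum_range_succ, ih]
      push_cast
      rw [show (n : ℝ) + 1 + 1 = n + 2 by ring]
      ring
  have hsumN := hsum N
  rw [hNh] at hsumN
  have hx3 : h ^ (3 - α) = h ^ 2 * h ^ (1 - α) := by
    rw [show 3 - α = (2 : ℕ) + (1 - α) by push_cast; ring, Real.rpow_add hh, Real.rpow_natCast]
  have hx3' : h ^ (3 - α) ≤ h ^ 2 * x ^ (1 - α) := by
    rw [hx3]
    gcongr
  have hmain : |∑ k ∈ Finset.range N, (h / 2 * (φ (((k : ℝ) + 1) * h)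
      + φ (((k : ℝ) + 2) * h)) - (Φ (((k : ℝ) + 2) * h) - Φ (((k : ℝ) + 1) * h)))| ≤
      5 * M * B * x ^ (1 - α) * h ^ 2 := by
    refine (Finset.abs_sum_le_sum_abs _ _).trans ((Finset.sum_le_sum hT).trans ?_)
    rw [← Finset.mul_sum]
    calc _ ≤ 5 * M * h ^ (3 - α) * (B * ((N : ℝ) + 1) ^ (1 - α)) := by gcongr; exact hB N
      _ = _ := by
        rw [hx3, ← hNh, Real.mul_rpow hN.le hh.le]; ring
  have hgoal : h * ∑ k ∈ Finset.range N, φ (((k : ℝ) + 1) * h) + h / 2 * φ x - Φ x =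
      ∑ k ∈ Finset.range N, (h / 2 * (φ (((k : ℝ) + 1) * h)
      + φ (((k : ℝ) + 2) * h)) - (Φ (((k : ℝ) + 2) * h) - Φ (((k : ℝ) + 1) * h)))
      + (h / 2 * φ h - Φ h) := by linarith
  change |h * ∑ k ∈ Finset.range N, φ (((k : ℝ) + 1) * h) + h / 2 * φ x - Φ x| ≤ _
  rw [hgoal]
  refine (abs_add_le _ _).trans ((add_le_add hmain hfirst).trans ?_)
  have := mul_le_mul_of_nonneg_left hx3' (by positivity : 0 ≤ 2 * M)
  linarith

theorem integral_rpow_neg_mul_eq {α x : ℝ} (hα1 : α < 1) (hx : 0 < x) (c d : ℝ) {r : ℝ → ℝ}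
    (hr : Continuous r) :
    ∫ t in (0 : ℝ)..x, t ^ (-α) * (c + t * d + r t) =
      c * (x ^ (1 - α) / (1 - α)) + d * (x ^ (2 - α) / (2 - α))
        + ∫ t in (0 : ℝ)..x, t ^ (-α) * r t := by
  have i0 : IntervalIntegrable (fun t : ℝ => t ^ (-α)) MeasureTheory.volume 0 x :=
    intervalIntegral.intervalIntegrable_rpow' (by linarith)
  have i1 : IntervalIntegrable (fun t : ℝ => t ^ (-α + 1)) MeasureTheory.volume 0 x :=
    intervalIntegral.intervalIntegrable_rpow' (by linarith)
  have i2 : IntervalIntegrable (fun t : ℝ => t ^ (-α) * r t) MeasureTheory.volume 0 x :=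
    i0.mul_continuousOn hr.continuousOn
  have hcongr : ∫ t in (0 : ℝ)..x, t ^ (-α) * (c + t * d + r t) =
      ∫ t in (0 : ℝ)..x, (c * t ^ (-α) + d * t ^ (-α + 1)) + t ^ (-α) * r t := by
    refine intervalIntegral.integral_congr fun t ht => ?_
    rw [uIcc_of_le hx.le] at ht
    rw [Real.rpow_add_one' ht.1 (by linarith)]
    ring
  rw [hcongr, intervalIntegral.integral_add ((i0.const_mul c).add (i1.const_mul d)) i2,
    intervalIntegral.integral_add (i0.const_mul c) (i1.const_mul d),
    intervalIntegral.integral_const_mul, intervalIntegral.integral_const_mul,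
    integral_rpow (Or.inl (by linarith)), integral_rpow (Or.inl (by linarith)),
    Real.zero_rpow (by linarith), Real.zero_rpow (by linarith)]
  rw [show -α + 1 + 1 = 2 - α by ring, show -α + 1 = 1 - α by ring]
  ring

/-- Asymptotics of right Riemann sums of `t ^ (-α) * g t` for `g` vanishing at the right endpoint. -/
theorem exists_riemannSum_rpow_mul_le {α x M : ℝ} (hα0 : 0 < α) (hα1 : α < 1) (hx : 0 < x)
    {g g' g'' : ℝ → ℝ} (hg : ∀ t, HasDerivAt g (g' t) t) (hg' : ∀ t, HasDerivAt g' (g'' t) t)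
    (hM : ∀ t ∈ Icc 0 x, |g'' t| ≤ M) (hgx : g x = 0) :
    ∃ C, 0 ≤ C ∧ ∀ N : ℕ, ∀ h : ℝ, ((N : ℝ) + 1) * h = x →
      |h * ∑ k ∈ Finset.range N, (((k : ℝ) + 1) * h) ^ (-α) * g (((k : ℝ) + 1) * h)
        - (∫ t in (0 : ℝ)..x, t ^ (-α) * g t) - zr α * g 0 * h ^ (1 - α)
        - zr (α - 1) * g' 0 * h ^ (2 - α)| ≤ C * h ^ 2 := by
  have h0m : (0 : ℝ) ∈ Icc 0 x := ⟨le_rfl, hx.le⟩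
  set r : ℝ → ℝ := fun t => g t - g 0 - t * g' 0 with hrdef
  have hr : ∀ t, HasDerivAt r (g' t - g' 0) t := fun t =>
    (((hg t).sub_const (g 0)).sub ((hasDerivAt_id t).mul_const (g' 0))).congr_deriv (by ring)
  have hrc : Continuous r := continuous_iff_continuousAt.2 fun t => (hr t).continuousAt
  obtain ⟨C0, hC0, H0⟩ := exists_abs_sum_rpow_sub_zr_le (s := α) (by linarith) hα1
  obtain ⟨C1, hC1, H1⟩ := exists_abs_sum_rpow_sub_zr_le (s := α - 1) (by linarith) (by linarith)
  obtain ⟨C2, hC2, H2⟩ := exists_trapezoid_rpow_mul_le hα0 hα1 hx hr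
    (fun t => (hg' t).sub_const (g' 0))
    (fun t ht => by simpa using abs_taylor_one_le hg hg' hM h0m ht)
    (fun t ht => by
      have := (convex_Icc 0 x).norm_image_sub_le_of_norm_hasDerivWithin_le
        (fun s _ => (hg' s).hasDerivWithinAt) hM h0m ht
      rwa [sub_zero, Real.norm_of_nonneg ht.1] at this) hM
  refine ⟨|g 0| * C0 * x ^ (-α) / x + |g' 0| * C1 * x ^ (-α) + C2, by positivity,
    fun N h hNh => ?_⟩
  have hN : (0 : ℝ) < (N : ℝ) + 1 := by positivity
  have hh : 0 < h := by
    by_contra! hneg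
    nlinarith
  specialize H0 N
  specialize H1 N
  specialize H2 N h hNh
  have hint : ∫ t in (0 : ℝ)..x, t ^ (-α) * g t = g 0 * (x ^ (1 - α) / (1 - α))
      + g' 0 * (x ^ (2 - α) / (2 - α)) + ∫ t in (0 : ℝ)..x, t ^ (-α) * r t := by
    rw [← integral_rpow_neg_mul_eq hα1 hx (g 0) (g' 0) hrc]
    congr 1
    funext t
    simp only [hrdef]
    ring
  have hsum : ∑ k ∈ Finset.range N, (((k : ℝ) + 1) * h) ^ (-α) * g (((k : ℝ) + 1) * h) =
      g 0 * h ^ (-α) * ∑ k ∈ Finset.range N, ((k : ℝ) + 1) ^ (-α)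
      + g' 0 * (h * h ^ (-α)) * ∑ k ∈ Finset.range N, ((k : ℝ) + 1) ^ (-(α - 1))
      + ∑ k ∈ Finset.range N, (((k : ℝ) + 1) * h) ^ (-α) * r (((k : ℝ) + 1) * h) := by
    rw [Finset.mul_sum, Finset.mul_sum, ← Finset.sum_add_distrib, ← Finset.sum_add_distrib]
    refine Finset.sum_congr rfl fun k _ => ?_
    have hk : (0 : ℝ) < (k : ℝ) + 1 := by positivity
    rw [Real.mul_rpow hk.le hh.le, show -(α - 1) = -α + 1 by ring, Real.rpow_add_one hk.ne']
    simp only [hrdef]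
    ring
  have pw1 : ∀ t : ℝ, 0 < t → t ^ (1 - α) = t * t ^ (-α) := fun t ht => by
    rw [show 1 - α = -α + 1 by ring, Real.rpow_add_one ht.ne', mul_comm]
  have pw2 : ∀ t : ℝ, 0 < t → t ^ (2 - α) = t ^ 2 * t ^ (-α) := fun t ht => by
    rw [show 2 - α = -α + 1 + 1 by ring, Real.rpow_add_one ht.ne', Real.rpow_add_one ht.ne']
    ring
  have hxP : x ^ (-α) = ((N : ℝ) + 1) ^ (-α) * h ^ (-α) := by
    rw [← hNh, Real.mul_rpow hN.le hh.le]
  rw [show -(α - 1) = 1 - α by ring, show 1 - (α - 1) = 2 - α by ring,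
    show 1 - α - 1 = -α by ring, pw1 _ hN, pw2 _ hN] at H1
  rw [Real.rpow_sub_one hN.ne', pw1 _ hN] at H0
  rw [show -(α - 1) = 1 - α by ring] at hsum
  rw [hsum, hint, pw1 _ hx, pw2 _ hx, pw1 _ hh, pw2 _ hh]
  have hrx : r x = -(g 0) - x * g' 0 := by simp only [hrdef, hgx]; ring
  rw [hrx] at H2
  set S0 := ∑ k ∈ Finset.range N, ((k : ℝ) + 1) ^ (-α)
  set S1 := ∑ k ∈ Finset.range N, ((k : ℝ) + 1) ^ (1 - α)
  set S2 := ∑ k ∈ Finset.range N, (((k : ℝ) + 1) * h) ^ (-α) * r (((k : ℝ) + 1) * h)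
  set I2 := ∫ t in (0 : ℝ)..x, t ^ (-α) * r t
  set n : ℝ := (N : ℝ) + 1
  have hQ : 0 < n ^ (-α) := Real.rpow_pos_of_pos hN _
  have hP : 0 < h ^ (-α) := Real.rpow_pos_of_pos hh _
  rw [hxP] at H2 ⊢
  set Q := n ^ (-α)
  set P := h ^ (-α)
  have key : h * (g 0 * P * S0 + g' 0 * (h * P) * S1 + S2)
      - (g 0 * (x * (Q * P) / (1 - α)) + g' 0 * (x ^ 2 * (Q * P) / (2 - α)) + I2)
      - zr α * g 0 * (h * P) - zr (α - 1) * g' 0 * (h ^ 2 * P) =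
      g 0 * (h * P) * (S0 + Q / 2 - n * Q / (1 - α) - zr α)
      + g' 0 * (h ^ 2 * P) * (S1 + n * Q / 2 - n ^ 2 * Q / (2 - α) - zr (α - 1))
      + (h * S2 + h / 2 * (Q * P * (-(g 0) - x * g' 0)) - I2) := by
    rw [← hNh]
    ring
  rw [key]
  have f0 : |g 0 * (h * P) * (S0 + Q / 2 - n * Q / (1 - α) - zr α)| ≤
      |g 0| * C0 * (Q * P) / x * h ^ 2 := by
    rw [abs_mul, abs_mul, abs_of_pos (mul_pos hh hP)]
    refine (mul_le_mul_of_nonneg_left H0 (by positivity)).trans_eq ?_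
    rw [← hNh]
    field_simp
  have f1 : |g' 0 * (h ^ 2 * P) * (S1 + n * Q / 2 - n ^ 2 * Q / (2 - α) - zr (α - 1))| ≤
      |g' 0| * C1 * (Q * P) * h ^ 2 := by
    rw [abs_mul, abs_mul, abs_of_pos (mul_pos (pow_pos hh 2) hP)]
    refine (mul_le_mul_of_nonneg_left H1 (by positivity)).trans_eq ?_
    ring
  refine (abs_add_le _ _).trans ((add_le_add ((abs_add_le _ _).trans (add_le_add f0 f1)) H2).trans
    (le_of_eq ?_))
  ring

theorem weighted_sum_eq (α : ℝ) (Y : ℕ → ℝ) (N : ℕ) (hN : 2 ≤ N) :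
    Y 0 + (2 : ℝ) ^ (-α) * Y 1
      + (∑ k ∈ Finset.Icc 2 (N - 1), (((k : ℝ) + 1) ^ (-α) - ((k : ℝ) - 1) ^ (-α)) * Y k)
      - ((N : ℝ) - 1) ^ (-α) * Y N - (N : ℝ) ^ (-α) * Y (N + 1) =
    ∑ k ∈ Finset.range N, ((k : ℝ) + 1) ^ (-α) * (Y k - Y (k + 2)) := by
  induction N, hN using Nat.le_induction with
  | base =>
    rw [Finset.sum_range_succ, Finset.sum_range_succ]
    norm_num
    ring
  | succ N hN ih =>
    rw [Finset.sum_range_succ, ← ih, Nat.add_sub_cancel]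
    obtain ⟨m, rfl⟩ : ∃ m, N = m + 1 := ⟨N - 1, by omega⟩
    rw [Nat.add_sub_cancel, Finset.sum_Icc_succ_top (by omega)]
    push_cast
    rw [show (m : ℝ) + 1 + 1 - 1 = m + 1 by ring]
    ring

/-- Replacing central differences of `y` by its derivative in a sum with weights `k ^ (-α)`. -/
theorem abs_sum_centralDifference_le {α x M B h : ℝ} {N : ℕ} {y y1 y2 y3 : ℝ → ℝ}
    (d0 : ∀ t, HasDerivAt y (y1 t) t) (d1 : ∀ t, HasDerivAt y1 (y2 t) t)
    (d2 : ∀ t, HasDerivAt y2 (y3 t) t) (hM : ∀ t ∈ Icc 0 x, |y3 t| ≤ M) (hM0 : 0 ≤ M)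
    (hh : 0 < h) (hNh : ((N : ℝ) + 1) * h = x)
    (hB : ∑ k ∈ Finset.range N, ((k : ℝ) + 1) ^ (-α) ≤ B * ((N : ℝ) + 1) ^ (1 - α)) :
    |h ^ (-α) * ∑ k ∈ Finset.range N, ((k : ℝ) + 1) ^ (-α) *
        (y (x - (k : ℝ) * h) - y (x - ((k : ℝ) + 2) * h))
      - 2 * h * ∑ k ∈ Finset.range N, (((k : ℝ) + 1) * h) ^ (-α) * y1 (x - ((k : ℝ) + 1) * h)| ≤
      2 * (M * B * x ^ (1 - α) * h ^ 2) := by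
  have hN : (0 : ℝ) < (N : ℝ) + 1 := by positivity
  have pw1 : h ^ (1 - α) = h * h ^ (-α) := by
    rw [show 1 - α = -α + 1 by ring, Real.rpow_add_one hh.ne', mul_comm]
  set P := h ^ (-α)
  have hP : 0 < P := Real.rpow_pos_of_pos hh _
  have hterm : ∀ k ∈ Finset.range N, |P * (((k : ℝ) + 1) ^ (-α) *
      (y (x - (k : ℝ) * h) - y (x - ((k : ℝ) + 2) * h)))
      - 2 * h * ((((k : ℝ) + 1) * h) ^ (-α) * y1 (x - ((k : ℝ) + 1) * h))| ≤
      2 * M * h ^ 3 * P * ((k : ℝ) + 1) ^ (-α) := by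
    intro k hk
    have hkN : (k : ℝ) + 1 ≤ N := by exact_mod_cast Finset.mem_range.1 hk
    have hk0 : (0 : ℝ) ≤ k := Nat.cast_nonneg k
    have mem : ∀ c : ℝ, 0 ≤ c → c ≤ (N : ℝ) + 1 → x - c * h ∈ Icc 0 x := fun c h1 h2 =>
      ⟨by rw [← hNh]; nlinarith, by nlinarith⟩
    have m0 := mem k hk0 (by linarith)
    have m1 := mem (k + 1) (by linarith) (by linarith)
    have m2 := mem (k + 2) (by linarith) (by linarith)
    have t1 := abs_taylor_two_le d0 d1 d2 hM m1 m0
    have t2 := abs_taylor_two_le d0 d1 d2 hM m1 m2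
    rw [show x - (k : ℝ) * h - (x - ((k : ℝ) + 1) * h) = h by ring, abs_of_pos hh] at t1
    rw [show x - ((k : ℝ) + 2) * h - (x - ((k : ℝ) + 1) * h) = -h by ring, abs_neg,
      abs_of_pos hh] at t2
    rw [Real.mul_rpow (by positivity) hh.le]
    have hq : 0 < ((k : ℝ) + 1) ^ (-α) := by positivity
    have : |y (x - (k : ℝ) * h) - y (x - ((k : ℝ) + 2) * h)
        - 2 * h * y1 (x - ((k : ℝ) + 1) * h)| ≤ 2 * M * h ^ 3 := by
      rw [abs_le] at t1 t2 ⊢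
      constructor <;> linarith
    calc _ = |P * ((k : ℝ) + 1) ^ (-α) * (y (x - (k : ℝ) * h) - y (x - ((k : ℝ) + 2) * h)
        - 2 * h * y1 (x - ((k : ℝ) + 1) * h))| := by congr 1; ring
      _ ≤ P * ((k : ℝ) + 1) ^ (-α) * (2 * M * h ^ 3) := by
        rw [abs_mul, abs_of_pos (by positivity)]
        gcongr
      _ = _ := by ring
  rw [Finset.mul_sum, Finset.mul_sum, ← Finset.sum_sub_distrib]
  refine (Finset.abs_sum_le_sum_abs _ _).trans ((Finset.sum_le_sum hterm).trans ?_)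
  rw [← Finset.mul_sum]
  calc _ ≤ 2 * M * h ^ 3 * P * (B * ((N : ℝ) + 1) ^ (1 - α)) := by gcongr
    _ = _ := by
      rw [← hNh, Real.mul_rpow hN.le hh.le, pw1]; ring

theorem expansion_Asigmabar
    (α x : ℝ) (hα0 : 0 < α) (hα1 : α < 1) (hx : 0 < x)
    (y : ℝ → ℝ) (hy : ContDiff ℝ (⊤ : ℕ∞) y) (hy'0 : deriv y 0 = 0) :
    ∃ C > 0, ∀ n : ℕ, 4 ≤ n →
      |(1 / (2 * Real.Gamma (1 - α) * (x / n) ^ α)) *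
          ((1 - 2 * zr α) * y x
            + ((2:ℝ) ^ (-α) + 2 * zr α) * y (x - x / n)
            + (∑ k ∈ Finset.Icc 2 (n - 2),
                (((k:ℝ) + 1) ^ (-α) - ((k:ℝ) - 1) ^ (-α)) * y (x - (k:ℝ) * (x / n)))
            + (-(((n:ℝ) - 2) ^ (-α))) * y (x - ((n:ℝ) - 1) * (x / n))
            + (-(((n:ℝ) - 1) ^ (-α))) * y (x - (n:ℝ) * (x / n)))
        - caputo α y x
        - ((zr α - 2 * zr (α - 1)) / (2 * Real.Gamma (1 - α))) *
            iteratedDeriv 2 y x * (x / n) ^ (2 - α)|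
      ≤ C * (x / n) ^ 2 := by
  have hdiff : ∀ {f : ℝ → ℝ}, ContDiff ℝ (⊤ : ℕ∞) f →
      ContDiff ℝ (⊤ : ℕ∞) (deriv f) ∧ ∀ t, HasDerivAt f (deriv f t) t := fun {f} hf =>
    have h := contDiff_infty_iff_deriv.1 hf
    ⟨h.2, fun t => (h.1 t).hasDerivAt⟩
  obtain ⟨hy1, d0⟩ := hdiff hy
  obtain ⟨hy2, d1⟩ := hdiff hy1
  obtain ⟨hy3, d2⟩ := hdiff hy2
  set y1 := deriv y
  set y2 := deriv y1
  set y3 := deriv y2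
  have hid : iteratedDeriv 2 y x = y2 x := by
    rw [iteratedDeriv_succ, iteratedDeriv_one]
  obtain ⟨M, hM⟩ := isCompact_Icc.exists_bound_of_continuousOn (s := Icc 0 x)
    hy3.continuous.continuousOn
  have hxm : x ∈ Icc 0 x := ⟨hx.le, le_rfl⟩
  have hM0 : 0 ≤ M := (norm_nonneg _).trans (hM x hxm)
  have hrefl : ∀ {f f' : ℝ → ℝ}, (∀ t, HasDerivAt f (f' t) t) →
      ∀ t, HasDerivAt (fun s => f (x - s)) (-f' (x - t)) t := fun {f f'} hf t => by
    simpa using (hf (x - t)).comp_const_sub x t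
  obtain ⟨B, hB0, hB⟩ := exists_sum_rpow_neg_le hα0 hα1
  obtain ⟨C, hC0, hC⟩ := exists_riemannSum_rpow_mul_le (M := M) hα0 hα1 hx
    (g := fun s => y1 (x - s)) (g' := fun s => -y2 (x - s)) (g'' := fun s => y3 (x - s))
    (hrefl d1) (fun t => (hrefl d2 t).neg.congr_deriv (neg_neg _))
    (fun t ht => hM _ ⟨by linarith [ht.2], by linarith [ht.1]⟩) (by simpa using hy'0)
  have hcap : ∫ t in (0 : ℝ)..x, y1 t / (x - t) ^ α =
      ∫ t in (0 : ℝ)..x, t ^ (-α) * y1 (x - t) := by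
    have := intervalIntegral.integral_comp_sub_left (a := 0) (b := x)
      (fun t => y1 t / (x - t) ^ α) x
    rw [sub_self, sub_zero] at this
    rw [← this]
    refine intervalIntegral.integral_congr fun t ht => ?_
    rw [uIcc_of_le hx.le] at ht
    rw [sub_sub_cancel, Real.rpow_neg ht.1, div_eq_inv_mul]
  have hG : 0 < Real.Gamma (1 - α) := Real.Gamma_pos_of_pos (by linarith)
  have hcaputo : caputo α y x =
      1 / Real.Gamma (1 - α) * ∫ t in (0 : ℝ)..x, t ^ (-α) * y1 (x - t) := by
    rw [← hcap]
    rfl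
  set G := Real.Gamma (1 - α)
  set D := (M * B * x ^ (1 - α) + |zr α| * M * x ^ (1 - α) + C) / G with hD
  refine ⟨D + 1, by positivity, fun n hn => ?_⟩
  obtain ⟨N, rfl⟩ : ∃ N, n = N + 1 := ⟨n - 1, by omega⟩
  have hN : (0 : ℝ) < (N : ℝ) + 1 := by positivity
  push_cast
  set h : ℝ := x / ((N : ℝ) + 1) with hh_def
  have hh : 0 < h := by positivity
  have hNh : ((N : ℝ) + 1) * h = x := by rw [hh_def]; field_simp
  have hhx : h ≤ x := by
    rw [← hNh]
    nlinarith [(Nat.cast_nonneg N : (0 : ℝ) ≤ N)]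
  specialize hC N h hNh
  have hW := weighted_sum_eq α (fun k => y (x - (k : ℝ) * h)) N (by omega)
  rw [show (N : ℝ) + 1 - 2 = N - 1 by ring, add_sub_cancel_right,
    hcaputo, hid]
  push_cast at hW
  simp only [zero_mul, sub_zero, one_mul] at hW
  set Sy := ∑ k ∈ Finset.Icc 2 (N - 1),
    (((k : ℝ) + 1) ^ (-α) - ((k : ℝ) - 1) ^ (-α)) * y (x - (k : ℝ) * h)
  set I := ∫ t in (0 : ℝ)..x, t ^ (-α) * y1 (x - t)
  set W := ∑ k ∈ Finset.range N, ((k : ℝ) + 1) ^ (-α) *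
    (y (x - (k : ℝ) * h) - y (x - ((k : ℝ) + 2) * h))
  set S := ∑ k ∈ Finset.range N, (((k : ℝ) + 1) * h) ^ (-α) * y1 (x - ((k : ℝ) + 1) * h)
  set P := h ^ (-α) with hPdef
  have hP : 0 < P := Real.rpow_pos_of_pos hh _
  have hPinv : h ^ α = P⁻¹ := by rw [hPdef, Real.rpow_neg hh.le, inv_inv]
  have pw1 : h ^ (1 - α) = h * P := by
    rw [show 1 - α = -α + 1 by ring, Real.rpow_add_one hh.ne', mul_comm]
  have pw2 : h ^ (2 - α) = h ^ 2 * P := by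
    rw [show 2 - α = -α + 1 + 1 by ring, Real.rpow_add_one hh.ne', Real.rpow_add_one hh.ne']
    ring
  have hcentral : |P * W - 2 * h * S| ≤ 2 * (M * B * x ^ (1 - α) * h ^ 2) :=
    abs_sum_centralDifference_le d0 d1 d2 hM hM0 hh hNh (hB N)
  have hend : |zr α * P * (y (x - h) - y x + h * y1 x - h ^ 2 / 2 * y2 x)| ≤
      |zr α| * M * x ^ (1 - α) * h ^ 2 := by
    have t := abs_taylor_two_le d0 d1 d2 hM hxm
      (show x - h ∈ Icc 0 x from ⟨by linarith, by linarith⟩)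
    rw [show x - h - x = -h by ring, abs_neg, abs_of_pos hh] at t
    have hx1 : h * P ≤ x ^ (1 - α) := by
      rw [← pw1]
      exact Real.rpow_le_rpow hh.le hhx (by linarith)
    calc _ = |zr α| * P * |y (x - h) - y x - -h * y1 x - (-h) ^ 2 / 2 * y2 x| := by
          rw [abs_mul, abs_mul, abs_of_pos hP]; congr 2; ring
      _ ≤ |zr α| * P * (M * h ^ 3) := by gcongr
      _ = |zr α| * M * (h * P) * h ^ 2 := by ring
      _ ≤ _ := by gcongr
  have hid2 : 1 / (2 * G * h ^ α) *
      ((1 - 2 * zr α) * y x + (2 ^ (-α) + 2 * zr α) * y (x - h) + Sy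
        + -(((N : ℝ) - 1) ^ (-α)) * y (x - (N : ℝ) * h)
        + -((N : ℝ) ^ (-α)) * y (x - ((N : ℝ) + 1) * h))
      - 1 / G * I - (zr α - 2 * zr (α - 1)) / (2 * G) * y2 x * h ^ (2 - α) =
      ((P * W - 2 * h * S) / 2
        + zr α * P * (y (x - h) - y x + h * y1 x - h ^ 2 / 2 * y2 x)
        + (h * S - I - zr α * y1 (x - 0) * h ^ (1 - α)
          - zr (α - 1) * -y2 (x - 0) * h ^ (2 - α))) / G := by
    rw [hPinv, pw1, pw2, ← hW, sub_zero]
    field_simp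
    ring
  rw [hid2, abs_div, abs_of_pos hG, div_le_iff₀ hG]
  have hc' : |(P * W - 2 * h * S) / 2| ≤ M * B * x ^ (1 - α) * h ^ 2 := by
    rw [abs_div, abs_two]; linarith
  refine (abs_add_le _ _).trans ((add_le_add ((abs_add_le _ _).trans
    (add_le_add hc' hend)) hC).trans ?_)
  have hDG : D * G = M * B * x ^ (1 - α) + |zr α| * M * x ^ (1 - α) + C := by
    rw [hD]; field_simp
  calc _ = D * G * h ^ 2 := by rw [hDG]; ring
    _ ≤ (D + 1) * h ^ 2 * G := by nlinarith [mul_pos hG (pow_pos hh 2)]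
end

section
/- Let 0 < α < 1 and let n ≥ 2 be an integer. Define W_n[α] = Σ_{k=1}^{n−1} k^{−α} − n^{1−α}/(1−α) − ζ(α). Then the weight σ_n = −(n−1)^{−α} + 2 W_n[α] satisfies −2/(n−1)^α < σ_n < −2/n^α. -/
/-- `W_n[α] = Σ_{k=1}^{n−1} k^{−α} − n^{1−α}/(1−α) − ζ(α)`. -/
noncomputable def W (n : ℕ) (α : ℝ) : ℝ :=
  (∑ k ∈ Finset.Icc 1 (n - 1), (k:ℝ) ^ (-α)) - (n:ℝ) ^ (1 - α) / (1 - α) - zr α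

open Complex Filter Topology Set

theorem hasDerivAt_ofReal_cpow_const_of_pos {x : ℝ} (hx : 0 < x) (r : ℂ) :
    HasDerivAt (fun y : ℝ => (y : ℂ) ^ r) (r * (x : ℂ) ^ (r - 1)) x := by
  have h := ((hasDerivAt_id (x : ℂ)).cpow_const (c := r) (by simp [hx])).comp_ofReal
  simpa using h

/-- The terms of a series representing `(s - 1) * ζ(s) - 1` on the half-plane `0 < re s`. -/
noncomputable def zetaTerm (n : ℕ) (s : ℂ) : ℂ :=
  (s - 1) * (n + 1 : ℂ) ^ (-s) + ((n + 2 : ℂ) ^ (1 - s) - (n + 1 : ℂ) ^ (1 - s))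

theorem norm_cpow_neg_sub_le {x y : ℝ} (hx : 0 < x) (hxy : x ≤ y) {s : ℂ} (hs : 0 < s.re) :
    ‖(y : ℂ) ^ (-s) - (x : ℂ) ^ (-s)‖ ≤ ‖s‖ * x ^ (-s.re - 1) * (y - x) := by
  refine norm_image_sub_le_of_norm_deriv_le_segment'
    (f := fun t : ℝ => (t : ℂ) ^ (-s))
    (fun t ht => (hasDerivAt_ofReal_cpow_const_of_pos (hx.trans_le ht.1) (-s)).hasDerivWithinAt)
    (fun t ht => ?_) y (right_mem_Icc.2 hxy)
  rw [norm_mul, norm_neg, norm_cpow_eq_rpow_re_of_pos (hx.trans_le ht.1)]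
  simp only [sub_re, neg_re, one_re]
  exact mul_le_mul_of_nonneg_left
    (Real.rpow_le_rpow_of_nonpos hx ht.1 (by linarith)) (norm_nonneg _)

theorem norm_zetaTerm_le (n : ℕ) {s : ℂ} (hs : 0 < s.re) :
    ‖zetaTerm n s‖ ≤ ‖1 - s‖ * ‖s‖ * (n + 1 : ℝ) ^ (-s.re - 1) := by
  have hn : (0 : ℝ) < n + 1 := by positivity
  have key := norm_image_sub_le_of_norm_deriv_le_segment'
    (f := fun t : ℝ => (t : ℂ) ^ (1 - s) - (1 - s) * ((n + 1 : ℝ) : ℂ) ^ (-s) * t)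
    (f' := fun t : ℝ => (1 - s) * (t : ℂ) ^ (-s) - (1 - s) * ((n + 1 : ℝ) : ℂ) ^ (-s))
    (a := n + 1) (b := n + 2) (C := ‖1 - s‖ * ‖s‖ * (n + 1 : ℝ) ^ (-s.re - 1))
    (fun t ht => by
      have h1 := hasDerivAt_ofReal_cpow_const_of_pos (hn.trans_le ht.1) (1 - s)
      have h2 := (hasDerivAt_id t).ofReal_comp.const_mul
        ((1 - s) * ((n + 1 : ℝ) : ℂ) ^ (-s))
      rw [show (1 - s - 1 : ℂ) = -s by ring] at h1
      rw [ofReal_one, mul_one] at h2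
      exact (h1.sub h2).hasDerivWithinAt)
    (fun t ht => by
      rw [← mul_sub, norm_mul, mul_assoc]
      refine mul_le_mul_of_nonneg_left ?_ (norm_nonneg _)
      refine (norm_cpow_neg_sub_le hn ht.1 hs).trans ?_
      refine mul_le_of_le_one_right (by positivity) ?_
      linarith [ht.2])
    (n + 2) (right_mem_Icc.2 (by linarith))
  rw [show (n + 2 - (n + 1) : ℝ) = 1 by ring, mul_one] at key
  refine le_of_eq_of_le (congrArg norm ?_) key
  simp only [zetaTerm]
  push_cast
  ring

theorem differentiable_zetaTerm (n : ℕ) : Differentiable ℂ (zetaTerm n) := by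
  have h1 : (n + 1 : ℂ) ≠ 0 := by exact_mod_cast n.succ_ne_zero
  have h2 : (n + 2 : ℂ) ≠ 0 := by exact_mod_cast (n + 1).succ_ne_zero
  unfold zetaTerm
  intro s
  refine ((differentiableAt_id.sub_const 1).mul ?_).add (DifferentiableAt.sub ?_ ?_)
  · exact (differentiableAt_id.neg).const_cpow (.inl h1)
  · exact (differentiableAt_id.const_sub 1).const_cpow (.inl h2)
  · exact (differentiableAt_id.const_sub 1).const_cpow (.inl h1)

theorem sum_range_zetaTerm (N : ℕ) (s : ℂ) :
    ∑ n ∈ Finset.range N, zetaTerm n s =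
      (s - 1) * ∑ n ∈ Finset.range N, (n + 1 : ℂ) ^ (-s) + (N + 1 : ℂ) ^ (1 - s) - 1 := by
  induction N with
  | zero => simp
  | succ N ih =>
    rw [Finset.sum_range_succ, Finset.sum_range_succ, ih, zetaTerm]
    push_cast
    rw [show (N + 1 + 1 : ℂ) = N + 2 by ring]
    ring

theorem summable_rpow_succ {a : ℝ} (ha : 0 < a) :
    Summable fun n : ℕ => (n + 1 : ℝ) ^ (-a - 1) := by
  have h := (summable_nat_add_iff 1).2 (Real.summable_nat_rpow.2 (by linarith : -a - 1 < -1))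
  simpa using h

theorem summable_zetaTerm {s : ℂ} (hs : 0 < s.re) : Summable fun n => zetaTerm n s :=
  .of_norm_bounded ((summable_rpow_succ hs).mul_left _) fun n => norm_zetaTerm_le n hs

theorem tsum_zetaTerm_of_one_lt_re {s : ℂ} (hs : 1 < s.re) :
    ∑' n, zetaTerm n s = riemannZeta₁ s - 1 := by
  have hs1 : s ≠ 1 := by rintro rfl; simp at hs
  have hsum : Summable fun n : ℕ => (n + 1 : ℂ) ^ (-s) := by
    have h := (summable_nat_add_iff 1).2 (Complex.summable_one_div_nat_cpow.2 hs)
    simpa [cpow_neg] using h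
  have hz : riemannZeta s = ∑' n : ℕ, (n + 1 : ℂ) ^ (-s) := by
    rw [zeta_eq_tsum_one_div_nat_add_one_cpow hs]
    simp [cpow_neg]
  have hpow : Tendsto (fun N : ℕ => (N + 1 : ℂ) ^ (1 - s)) atTop (𝓝 0) := by
    rw [tendsto_zero_iff_norm_tendsto_zero]
    have h := (tendsto_rpow_neg_atTop (sub_pos.2 hs)).comp
      ((tendsto_natCast_atTop_atTop (R := ℝ)).atTop_add (tendsto_const_nhds (x := (1 : ℝ))))
    refine h.congr fun N => ?_
    have := norm_cpow_eq_rpow_re_of_pos (by positivity : (0 : ℝ) < N + 1) (1 - s)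
    push_cast at this
    simp [this]
  have h1 := (summable_zetaTerm (zero_lt_one.trans hs)).hasSum.tendsto_sum_nat
  have h2 := ((hsum.hasSum.tendsto_sum_nat.const_mul (s - 1)).add hpow).sub_const 1
  rw [tendsto_nhds_unique h1 (h2.congr fun N => (sum_range_zetaTerm N s).symm), ← hz,
    riemannZeta_eq_inv_sub_mul hs1, mul_inv_cancel_left₀ (sub_ne_zero.2 hs1), add_zero]

theorem tsum_zetaTerm {s : ℂ} (hs : 0 < s.re) :
    ∑' n, zetaTerm n s = riemannZeta₁ s - 1 := by
  set a := s.re / 2 with ha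
  set R := ‖s‖ + 3 with hR
  set U : Set ℂ := {z | a < z.re} ∩ Metric.ball 0 R with hU
  have ha0 : 0 < a := by positivity
  have hUo : IsOpen U := (isOpen_lt continuous_const continuous_re).inter Metric.isOpen_ball
  have hUc : Convex ℝ U := (convex_halfSpace_re_gt a).inter (convex_ball 0 R)
  have hsU : s ∈ U := ⟨by simp only [mem_ofPred_eq]; linarith, by simp [hR]⟩
  have hsre : s.re ≤ ‖s‖ := re_le_norm s
  set z₀ : ℂ := ((s.re / 2 + 2 : ℝ) : ℂ) with hz₀
  have hz₀U : z₀ ∈ U := by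
    refine ⟨by simp only [mem_ofPred_eq, hz₀, ofReal_re]; linarith, ?_⟩
    rw [mem_ball_zero_iff, hz₀, norm_real, Real.norm_of_nonneg (by linarith)]
    linarith
  have hd : DifferentiableOn ℂ (fun z => ∑' n, zetaTerm n z) U := by
    refine differentiableOn_tsum_of_summable_norm
      ((summable_rpow_succ ha0).mul_left ((1 + R) * R))
      (fun n => (differentiable_zetaTerm n).differentiableOn) hUo fun n z hz => ?_
    have hzR : ‖z‖ ≤ R := (mem_ball_zero_iff.1 hz.2).le
    have hza : a < z.re := hz.1
    have h1z : ‖1 - z‖ ≤ 1 + R := (norm_sub_le _ _).trans (by simpa using hzR)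
    refine (norm_zetaTerm_le n (ha0.trans hza)).trans ?_
    gcongr
    linarith [n.cast_nonneg (α := ℝ)]
  refine (hd.analyticOnNhd hUo).eqOn_of_preconnected_of_eventuallyEq
    ((differentiable_riemannZeta₁.sub_const 1).differentiableOn.analyticOnNhd hUo)
    hUc.isPreconnected hz₀U ?_ hsU
  filter_upwards [(isOpen_lt continuous_const continuous_re).mem_nhds
    (show (1 : ℝ) < z₀.re by simp only [hz₀, ofReal_re]; linarith)] with z hz
  exact tsum_zetaTerm_of_one_lt_re hz

theorem W_succ_eq (N : ℕ) (α : ℝ) :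
    W (N + 1) α =
      ∑ k ∈ Finset.range N, (k + 1 : ℝ) ^ (-α) - (N + 1 : ℝ) ^ (1 - α) / (1 - α) - zr α := by
  have h : ∑ k ∈ Finset.Icc 1 N, (k : ℝ) ^ (-α) =
      ∑ k ∈ Finset.range N, (k + 1 : ℝ) ^ (-α) := by
    induction N with
    | zero => simp
    | succ N ih =>
      rw [Finset.sum_Icc_succ_top (by lia), Finset.sum_range_succ, ih]
      push_cast
      rfl
  rw [W, Nat.add_sub_cancel, h]
  push_cast
  rfl

theorem tendsto_W_succ {α : ℝ} (hα0 : 0 < α) (hα1 : α < 1) :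
    Tendsto (fun N : ℕ => W (N + 1) α) atTop (𝓝 0) := by
  have hα : (α : ℂ) ≠ 1 := by exact_mod_cast hα1.ne
  have hs : 0 < (α : ℂ).re := by simpa using hα0
  have h := (summable_zetaTerm hs).hasSum.tendsto_sum_nat
  rw [tsum_zetaTerm hs] at h
  have hre := (continuous_re.tendsto _).comp h
  have hζ : (riemannZeta₁ α - 1).re = (α - 1) * zr α - 1 := by
    have : riemannZeta₁ α = ((α - 1 : ℝ) : ℂ) * riemannZeta α := by
      rw [riemannZeta_eq_inv_sub_mul hα]
      push_cast
      rw [mul_inv_cancel_left₀ (sub_ne_zero.2 hα)]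
    rw [this, sub_re, re_ofReal_mul, one_re, zr]
  rw [hζ] at hre
  have hα1' : α - 1 ≠ 0 := by linarith
  have h3 := (((hre.add_const 1).sub_const ((α - 1) * zr α)).const_mul (α - 1)⁻¹)
  rw [show (α - 1)⁻¹ * ((α - 1) * zr α - 1 + 1 - (α - 1) * zr α) = 0 by ring] at h3
  refine h3.congr fun N => ?_
  have hcast : ∑ n ∈ Finset.range N, zetaTerm n α =
      (((α - 1) * ∑ n ∈ Finset.range N, (n + 1 : ℝ) ^ (-α) + (N + 1 : ℝ) ^ (1 - α) - 1 : ℝ) : ℂ) := by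
    rw [sum_range_zetaTerm]
    push_cast
    rw [ofReal_cpow (by positivity)]
    simp_rw [ofReal_cpow (by positivity : (0 : ℝ) ≤ (_ : ℕ) + 1)]
    push_cast
    rfl
  have h1α : 1 - α ≠ 0 := by linarith
  rw [Function.comp_apply, hcast, ofReal_re, W_succ_eq]
  field_simp
  ring

theorem strictConvexOn_rpow_neg {α : ℝ} (hα : 0 < α) :
    StrictConvexOn ℝ (Ioi 0) fun x : ℝ => x ^ (-α) := by
  refine StrictMonoOn.strictConvexOn_of_deriv (convex_Ioi 0)
    (fun x hx => (Real.continuousAt_rpow_const x _ (.inl hx.ne')).continuousWithinAt) ?_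
  rw [interior_Ioi]
  intro x hx y hy hxy
  rw [(Real.hasDerivAt_rpow_const (.inl (ne_of_gt hx))).deriv,
    (Real.hasDerivAt_rpow_const (.inl (ne_of_gt hy))).deriv]
  have := Real.rpow_lt_rpow_of_neg hx hxy (by linarith : -α - 1 < 0)
  nlinarith

theorem hasDerivAt_rpow_primitive {α x : ℝ} (hα : α ≠ 1) (hx : 0 < x) :
    HasDerivAt (fun t : ℝ => t ^ (1 - α) / (1 - α)) (x ^ (-α)) x := by
  have h := (Real.hasDerivAt_rpow_const (p := 1 - α) (.inl hx.ne')).div_const (1 - α)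
  rwa [mul_div_cancel_left₀ _ (sub_ne_zero.2 hα.symm), show 1 - α - 1 = -α by ring] at h

/-- The quadratic `t * p + t ^ 2 / 2 * q` grows slower than a function whose derivative exceeds
`p + t * q`. -/
theorem add_half_lt_sub_of_hasDerivAt {f g : ℝ → ℝ} {x p q : ℝ}
    (hg : ∀ t ∈ Icc (0 : ℝ) 1, HasDerivAt g (f (x + t)) (x + t))
    (hf : ∀ t ∈ Ioo (0 : ℝ) 1, p + t * q < f (x + t)) :
    p + q / 2 < g (x + 1) - g x := by
  have hd : ∀ t ∈ Icc (0 : ℝ) 1,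
      HasDerivAt (fun t => g (x + t) - (t * p + t ^ 2 / 2 * q)) (f (x + t) - (p + t * q)) t := by
    intro t ht
    have h1 : HasDerivAt (fun t => g (x + t)) (f (x + t)) t := (hg t ht).comp_const_add x t
    have h2 : HasDerivAt (fun t : ℝ => t * p + t ^ 2 / 2 * q) (p + t * q) t := by
      have := ((hasDerivAt_id t).mul_const p).add
        ((((hasDerivAt_id t).pow 2).div_const 2).mul_const q)
      refine this.congr_deriv ?_
      norm_num
    exact h1.sub h2
  have hm := strictMonoOn_of_deriv_pos (convex_Icc (0 : ℝ) 1)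
    (fun t ht => (hd t ht).continuousAt.continuousWithinAt)
    (fun t ht => by
      rw [interior_Icc] at ht
      rw [(hd t (Ioo_subset_Icc_self ht)).deriv]
      linarith [hf t ht])
    (left_mem_Icc.2 zero_le_one) (right_mem_Icc.2 zero_le_one) zero_lt_one
  norm_num at hm
  linarith

theorem rpow_primitive_sub_lt {α x : ℝ} (hα0 : 0 < α) (hα1 : α ≠ 1) (hx : 0 < x) :
    (x + 1) ^ (1 - α) / (1 - α) - x ^ (1 - α) / (1 - α) <
      (x ^ (-α) + (x + 1) ^ (-α)) / 2 := by
  have h := add_half_lt_sub_of_hasDerivAt (f := fun t => -t ^ (-α))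
    (g := fun t => -(t ^ (1 - α) / (1 - α))) (x := x)
    (p := -x ^ (-α)) (q := x ^ (-α) - (x + 1) ^ (-α))
    (fun t ht => (hasDerivAt_rpow_primitive hα1 (by linarith [ht.1])).neg)
    (fun t ht => by
      have := (strictConvexOn_rpow_neg hα0).2 (x := x) (y := x + 1) hx
        (by simp only [mem_Ioi]; linarith) (by simp) (sub_pos.2 ht.2) ht.1 (by ring)
      simp only [smul_eq_mul] at this
      rw [show (1 - t) * x + t * (x + 1) = x + t by ring] at this
      linarith)
  linarith

theorem lt_rpow_primitive_sub {α x : ℝ} (hα0 : 0 < α) (hα1 : α ≠ 1) (hx : 1 < x) :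
    3 / 2 * x ^ (-α) - (x - 1) ^ (-α) / 2 <
      (x + 1) ^ (1 - α) / (1 - α) - x ^ (1 - α) / (1 - α) := by
  have h := add_half_lt_sub_of_hasDerivAt (f := fun t => t ^ (-α))
    (g := fun t => t ^ (1 - α) / (1 - α)) (x := x)
    (p := x ^ (-α)) (q := x ^ (-α) - (x - 1) ^ (-α))
    (fun t ht => hasDerivAt_rpow_primitive hα1 (by linarith [ht.1]))
    (fun t ht => by
      have ht0 := ht.1
      have h1t : 0 < 1 + t := by linarith
      have hne : x - 1 ≠ x + t := by linarith
      have hab : t / (1 + t) + 1 / (1 + t) = 1 := by field_simp; ring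
      have := (strictConvexOn_rpow_neg hα0).2 (mem_Ioi.2 (sub_pos.2 hx))
        (mem_Ioi.2 (by linarith : 0 < x + t)) hne (by positivity) (by positivity) hab
      simp only [smul_eq_mul] at this
      rw [show t / (1 + t) * (x - 1) + 1 / (1 + t) * (x + t) = x by field_simp; ring] at this
      have h2 := mul_lt_mul_of_pos_left this h1t
      rw [show (1 + t) * (t / (1 + t) * (x - 1) ^ (-α) + 1 / (1 + t) * (x + t) ^ (-α)) =
        t * (x - 1) ^ (-α) + (x + t) ^ (-α) by field_simp] at h2
      linarith)
  linarith

theorem W_succ_sub (N : ℕ) (α : ℝ) :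
    W (N + 2) α - W (N + 1) α = (N + 1 : ℝ) ^ (-α) -
      ((N + 1 + 1 : ℝ) ^ (1 - α) / (1 - α) - (N + 1 : ℝ) ^ (1 - α) / (1 - α)) := by
  rw [W_succ_eq N, W_succ_eq (N + 1), Finset.sum_range_succ]
  push_cast
  ring

theorem tendsto_natCast_add_one_rpow_neg {α : ℝ} (hα : 0 < α) :
    Tendsto (fun N : ℕ => (N + 1 : ℝ) ^ (-α)) atTop (𝓝 0) :=
  (tendsto_rpow_neg_atTop hα).comp
    ((tendsto_natCast_atTop_atTop (R := ℝ)).atTop_add (tendsto_const_nhds (x := (1 : ℝ))))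

theorem W_succ_le {α : ℝ} (hα0 : 0 < α) (hα1 : α < 1) (N : ℕ) :
    W (N + 1) α ≤ -(N + 1 : ℝ) ^ (-α) / 2 := by
  have hmono : Monotone fun N : ℕ => W (N + 1) α + (N + 1 : ℝ) ^ (-α) / 2 := by
    refine monotone_nat_of_le_succ fun N => ?_
    have h1 := W_succ_sub N α
    have h2 := rpow_primitive_sub_lt hα0 hα1.ne (by positivity : (0 : ℝ) < N + 1)
    push_cast
    linarith
  have hlim := (tendsto_W_succ hα0 hα1).add
    ((tendsto_natCast_add_one_rpow_neg hα0).div_const 2)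
  have := hmono.ge_of_tendsto hlim N
  simp only [zero_div, add_zero] at this
  linarith

theorem lt_W_add_two {α : ℝ} (hα0 : 0 < α) (hα1 : α < 1) (N : ℕ) :
    -(N + 1 : ℝ) ^ (-α) / 2 < W (N + 2) α := by
  have hanti : StrictAnti fun N : ℕ => W (N + 2) α + (N + 1 : ℝ) ^ (-α) / 2 := by
    refine strictAnti_nat_of_succ_lt fun N => ?_
    have h1 := W_succ_sub (N + 1) α
    have h2 := lt_rpow_primitive_sub hα0 hα1.ne
      (by linarith [N.cast_nonneg (α := ℝ)] : (1 : ℝ) < N + 1 + 1)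
    rw [add_sub_cancel_right] at h2
    push_cast at h1 ⊢
    linarith
  have hlim := ((tendsto_W_succ hα0 hα1).comp (tendsto_add_atTop_nat 1)).add
    ((tendsto_natCast_add_one_rpow_neg hα0).div_const 2)
  have h0 := hanti.antitone.le_of_tendsto hlim (N + 1)
  have h1 := hanti N.lt_succ_self
  simp only [zero_div, add_zero, Nat.succ_eq_add_one] at h0 h1
  linarith

theorem weight_n_bounds
    (α : ℝ) (hα0 : 0 < α) (hα1 : α < 1) (n : ℕ) (hn : 2 ≤ n) :
    -(2 / ((n:ℝ) - 1) ^ α) < -(((n:ℝ) - 1) ^ (-α)) + 2 * W n α ∧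
    -(((n:ℝ) - 1) ^ (-α)) + 2 * W n α < -(2 / (n:ℝ) ^ α) := by
  obtain ⟨N, rfl⟩ := Nat.exists_eq_add_of_le' hn
  have hN : (0 : ℝ) < N + 1 := by positivity
  have hlow := lt_W_add_two hα0 hα1 N
  have hupp := W_succ_le hα0 hα1 (N + 1)
  have hlt := Real.rpow_lt_rpow_of_neg hN (by linarith : (N + 1 : ℝ) < N + 2)
    (by linarith : -α < 0)
  push_cast at hupp ⊢
  rw [show (N + 1 + 1 : ℝ) = N + 2 by ring] at hupp
  rw [show (N + 2 - 1 : ℝ) = N + 1 by ring, div_eq_mul_inv, div_eq_mul_inv,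
    ← Real.rpow_neg hN.le, ← Real.rpow_neg (by positivity)]
  constructor <;> linarith
end
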